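/- Let 𝒮 be a set of symmetric, pairwise commuting real n×n matrices with 0 ≼ S ≼ Iₙ for every S ∈ 𝒮, let Ŝ, S_μ ∈ 𝒮, and let Ĝ, G_μ : 𝒮 → ℝ be functions such that Ĝ(Ŝ) ≤ Ĝ(S_μ) and M_μ(S_μ) ≤ M_μ(S) for all S ∈ 𝒮. Set m* := M_μ(S_μ), fix x > 0, and let r_x := max(√(3m*), 7x) and L(S, x) := [d²(S, S_μ) + r_x²]·x / r_x. If |D̂(S) − D̂(S_μ)| ≤ L(S, x) and |D_μ(S) − D_μ(S_μ)| ≤ L(S, x) for all S ∈ 𝒮, where D̂(S) := Ĝ(S) − M_μ(S) and D_μ(S) := G_μ(S) − M_μ(S), then |G_μ(Ŝ) − G_μ(S_μ)| ≤ 4x·r_x. -/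

import Mathlib

open Matrix

/-- `M_μ(S) := μᵀ(I−S)²μ + σ²·tr(S²)`. -/
noncomputable def Mmu {n : ℕ} (μ : Fin n → ℝ) (σ : ℝ)
    (S : Matrix (Fin n) (Fin n) ℝ) : ℝ :=
  μ ⬝ᵥ ((1 - S) ^ 2).mulVec μ + σ ^ 2 * (S ^ 2).trace

/-- `d²(S₁,S₂) := μᵀ(S₁−S₂)²μ + σ²·tr((S₁−S₂)²)`. -/
noncomputable def dSq {n : ℕ} (μ : Fin n → ℝ) (σ : ℝ)
    (S₁ S₂ : Matrix (Fin n) (Fin n) ℝ) : ℝ :=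
  μ ⬝ᵥ ((S₁ - S₂) ^ 2).mulVec μ + σ ^ 2 * ((S₁ - S₂) ^ 2).trace

open scoped MatrixOrder in
lemma aux_psd {n : ℕ} {A B : Matrix (Fin n) (Fin n) ℝ} (hA : A.PosSemidef) (hB : B.PosSemidef)
    (h : A * B = B * A) : (A * B).PosSemidef := by
  rw [← Matrix.nonneg_iff_posSemidef] at *
  exact Commute.mul_nonneg hA hB h

lemma aux_q {n : ℕ} (μ : Fin n → ℝ) {A : Matrix (Fin n) (Fin n) ℝ} (hA : A.PosSemidef) :
    0 ≤ μ ⬝ᵥ A.mulVec μ := by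
  simpa using hA.dotProduct_mulVec_nonneg μ

lemma aux_d {n : ℕ} (μ : Fin n → ℝ) (σ : ℝ) {S T : Matrix (Fin n) (Fin n) ℝ}
    (hS : S.PosSemidef) (hT : T.PosSemidef) (hS' : (1 - S).PosSemidef) (hT' : (1 - T).PosSemidef)
    (h : S * T = T * S) : dSq μ σ S T ≤ Mmu μ σ S + Mmu μ σ T := by
  have h' : (1 - S) * (1 - T) = (1 - T) * (1 - S) := by
    simp only [mul_sub, sub_mul, mul_one, one_mul, h]; abel
  have h1 := aux_q μ (aux_psd hS' hT' h')
  have h2 := (aux_psd hS hT h).trace_nonneg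
  have e1 : (S - T) ^ 2 = (1 - S) ^ 2 + (1 - T) ^ 2 - (2 : ℝ) • ((1 - S) * (1 - T)) := by
    rw [two_smul]; nth_rewrite 2 [h']; noncomm_ring
  have e2 : (S - T) ^ 2 = S ^ 2 + T ^ 2 - (2 : ℝ) • (S * T) := by
    rw [two_smul]; nth_rewrite 2 [h]; noncomm_ring
  have q1 : μ ⬝ᵥ ((S - T) ^ 2).mulVec μ = μ ⬝ᵥ ((1 - S) ^ 2).mulVec μ
      + μ ⬝ᵥ ((1 - T) ^ 2).mulVec μ - 2 * (μ ⬝ᵥ ((1 - S) * (1 - T)).mulVec μ) := by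
    rw [e1, Matrix.sub_mulVec, Matrix.add_mulVec, Matrix.smul_mulVec, dotProduct_sub,
      dotProduct_add, dotProduct_smul, smul_eq_mul]
  have q2 : ((S - T) ^ 2).trace = (S ^ 2).trace + (T ^ 2).trace - 2 * (S * T).trace := by
    rw [e2, Matrix.trace_sub, Matrix.trace_add, Matrix.trace_smul, smul_eq_mul]
  unfold dSq Mmu
  rw [q1, q2]
  nlinarith [mul_nonneg (sq_nonneg σ) h2]

/-- Deterministic part of the main theorem: if `Ŝ` minimizes `Ĝ`, `S_μ` minimizes
`M_μ` over a commuting family `𝒮` of symmetric matrices with `0 ≼ S ≼ I`, and the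
fluctuations `D̂(S) := Ĝ(S) − M_μ(S)` and `D_μ(S) := G_μ(S) − M_μ(S)` both satisfy
`|D(S) − D(S_μ)| ≤ L(S,x)` on `𝒮`, with `L(S,x) = (d²(S,S_μ) + r_x²)·x / r_x` and
`r_x = max(√(3m*), 7x)`, then `|G_μ(Ŝ) − G_μ(S_μ)| ≤ 4 x r_x`. -/
theorem Gmu_diff_le {n : ℕ} (μ : Fin n → ℝ) (σ : ℝ) (hσ : 0 < σ)
    (𝒮 : Set (Matrix (Fin n) (Fin n) ℝ))
    (hpsd : ∀ S ∈ 𝒮, S.PosSemidef) (hle : ∀ S ∈ 𝒮, ((1 : Matrix (Fin n) (Fin n) ℝ) - S).PosSemidef)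
    (hcomm : ∀ S₁ ∈ 𝒮, ∀ S₂ ∈ 𝒮, S₁ * S₂ = S₂ * S₁)
    (Shat Sμ : Matrix (Fin n) (Fin n) ℝ) (hShat : Shat ∈ 𝒮) (hSμ : Sμ ∈ 𝒮)
    (Ghat Gmu : Matrix (Fin n) (Fin n) ℝ → ℝ)
    (hminGhat : Ghat Shat ≤ Ghat Sμ)
    (hminM : ∀ S ∈ 𝒮, Mmu μ σ Sμ ≤ Mmu μ σ S)
    (x : ℝ) (hx : 0 < x)
    (hLhat : ∀ S ∈ 𝒮,
      |(Ghat S - Mmu μ σ S) - (Ghat Sμ - Mmu μ σ Sμ)| ≤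
        (dSq μ σ S Sμ + (max (Real.sqrt (3 * Mmu μ σ Sμ)) (7 * x)) ^ 2) * x /
          max (Real.sqrt (3 * Mmu μ σ Sμ)) (7 * x))
    (hLmu : ∀ S ∈ 𝒮,
      |(Gmu S - Mmu μ σ S) - (Gmu Sμ - Mmu μ σ Sμ)| ≤
        (dSq μ σ S Sμ + (max (Real.sqrt (3 * Mmu μ σ Sμ)) (7 * x)) ^ 2) * x /
          max (Real.sqrt (3 * Mmu μ σ Sμ)) (7 * x)) :
    |Gmu Shat - Gmu Sμ| ≤ 4 * x * max (Real.sqrt (3 * Mmu μ σ Sμ)) (7 * x) := by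
  have hd := aux_d μ σ (hpsd _ hShat) (hpsd _ hSμ) (hle _ hShat) (hle _ hSμ)
    (hcomm _ hShat _ hSμ)
  have h1 := hLhat _ hShat
  have h2 := hLmu _ hShat
  have hm := hminM _ hShat
  have hm0 : 0 ≤ Mmu μ σ Sμ := by
    have a := aux_q μ (aux_psd (hle _ hSμ) (hle _ hSμ) rfl)
    have b := (aux_psd (hpsd _ hSμ) (hpsd _ hSμ) rfl).trace_nonneg
    unfold Mmu
    rw [pow_two (1 - Sμ), pow_two Sμ]
    have := mul_nonneg (sq_nonneg σ) b
    linarith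
  have hr1 : √(3 * Mmu μ σ Sμ) ≤ max (√(3 * Mmu μ σ Sμ)) (7 * x) := le_max_left _ _
  have hr2 : 7 * x ≤ max (√(3 * Mmu μ σ Sμ)) (7 * x) := le_max_right _ _
  have hr3 := (Real.sqrt_le_left (by linarith)).1 hr1
  generalize max (√(3 * Mmu μ σ Sμ)) (7 * x) = r at *
  have hr : 0 < r := by linarith
  rw [abs_le] at h1 h2 ⊢
  obtain ⟨h1a, h1b⟩ := h1
  obtain ⟨h2a, h2b⟩ := h2
  have hd0 : 0 ≤ dSq μ σ Shat Sμ + r ^ 2 := by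
    by_contra! hc
    have : (dSq μ σ Shat Sμ + r ^ 2) * x / r < 0 := div_neg_of_neg_of_pos (by nlinarith) hr
    linarith
  have hL : (dSq μ σ Shat Sμ + r ^ 2) * x / r ≤ (dSq μ σ Shat Sμ + r ^ 2) / 7 := by
    rw [div_le_div_iff₀ hr (by norm_num)]
    nlinarith
  have hD : dSq μ σ Shat Sμ ≤ r ^ 2 := by nlinarith
  have hL2 : (dSq μ σ Shat Sμ + r ^ 2) * x / r ≤ 2 * x * r := by
    rw [div_le_iff₀ hr]
    nlinarith
  have := mul_pos hx hr
  constructor <;> linarith
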